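/- arXiv:2411.08419 — 3 statements merged into one kernel-verified Lean document; each statement's English description precedes it below -/
import Mathlib

section
/- Let N be a finite set partitioned into disjoint subsets N₁, N₂, N₃ with N₂ nonempty. For each i ∈ N let p_i ∈ (0,1) with Σ_{i∈N} p_i = 1, let δ_i ∈ (0, 1/2], and let e_i ≥ 0. Let I ⊆ ℝ be an open interval with |N₁| < k for every k ∈ I, and let V_L, V^Δ : I → ℝ be differentiable with V^Δ(k) > 0 on I and satisfying, for every k ∈ I: (i) Σ_{i∈N₂} [(1/δ_i − p_i)V^Δ(k) − p_i V_L(k) + e_i] + Σ_{i∈N₁} (1−p_i)·V^Δ(k) = (k−1)·V^Δ(k); and (ii) Σ_{i∈N₁} [δ_i/(1−δ_i)]·(p_i V_L(k) − e_i) + (k − |N₁|)·V^Δ(k) + V_L(k) = 1. Define μ_i(k) := 1−p_i for i ∈ N₁, μ_i(k) := 1/δ_i − p_i − (p_i V_L(k) − e_i)/V^Δ(k) for i ∈ N₂, and μ_i(k) := 0 for i ∈ N₃, and suppose 0 ≤ μ_i(k) ≤ 1−p_i for all i ∈ N₂ and k ∈ I. Then on I the function V_L is non-increasing, V^Δ is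 non-decreasing, and for every i ∈ N the effective prize spread k ↦ V_L(k) + V^Δ(k) − μ_i(k)·V^Δ(k)/(1−p_i) is non-increasing. -/
theorem psm_aux (P2 Q B K h x y w : ℝ) (hP2 : 0 < P2) (hP21 : P2 ≤ 1) (hQ : 0 ≤ Q) (hB : 0 ≤ B)
    (hK : 0 < K) (hh : 0 ≤ h) (hw : 0 < w) (h1 : B * y - P2 * x = h * w)
    (h2 : (1 + Q) * x + K * y = -(h * w)) (h3 : 1 + Q ≤ K + B + P2) :
    x ≤ 0 ∧ 0 ≤ y ∧ x + y ≤ 0 := by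
  have hd : 0 < P2 * K + B * (1 + Q) := by positivity
  have hhw : 0 ≤ h * w := by positivity
  have ex : (P2 * K + B * (1 + Q)) * x = -(h * w * (K + B)) := by
    linear_combination B * h2 - K * h1
  have ey : (P2 * K + B * (1 + Q)) * y = h * w * (1 + Q - P2) := by
    linear_combination P2 * h2 + (1 + Q) * h1
  refine ⟨?_, ?_, ?_⟩
  · refine nonpos_of_mul_nonpos_right ?_ hd
    rw [ex]
    have : 0 ≤ h * w * (K + B) := by positivity
    linarith
  · refine nonneg_of_mul_nonneg_right ?_ hd
    rw [ey]
    exact mul_nonneg hhw (by linarith)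
  · refine nonpos_of_mul_nonpos_right ?_ hd
    rw [mul_add, ex, ey]
    have : 0 ≤ h * w * (K + B + P2 - (1 + Q)) := mul_nonneg hhw (by linarith)
    linarith

/-- Analytic core of Theorem 3: monotonicity of `V_L`, `V^Δ`, and of each
agent's effective prize spread in a continuous voting-rule parameter `k`,
when all discount factors are at most `1/2`. -/
theorem prize_spread_monotone {ι : Type*} [Fintype ι] [DecidableEq ι]
    (N₁ N₂ N₃ : Finset ι)
    (hdisj12 : Disjoint N₁ N₂) (hdisj13 : Disjoint N₁ N₃) (hdisj23 : Disjoint N₂ N₃)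
    (hcover : N₁ ∪ N₂ ∪ N₃ = Finset.univ) (hN₂ : N₂.Nonempty)
    (p δ e : ι → ℝ)
    (hp : ∀ i, 0 < p i ∧ p i < 1) (hpsum : ∑ i, p i = 1)
    (hδ : ∀ i, 0 < δ i ∧ δ i ≤ 1 / 2) (he : ∀ i, 0 ≤ e i)
    (a b : ℝ) (hI : ∀ k ∈ Set.Ioo a b, (N₁.card : ℝ) < k)
    (VL VΔ : ℝ → ℝ)
    (hVLdiff : ∀ k ∈ Set.Ioo a b, DifferentiableAt ℝ VL k)
    (hVΔdiff : ∀ k ∈ Set.Ioo a b, DifferentiableAt ℝ VΔ k)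
    (hVΔpos : ∀ k ∈ Set.Ioo a b, 0 < VΔ k)
    -- (i)
    (hid1 : ∀ k ∈ Set.Ioo a b,
      (∑ i ∈ N₂, ((1 / δ i - p i) * VΔ k - p i * VL k + e i))
        + (∑ i ∈ N₁, (1 - p i)) * VΔ k = (k - 1) * VΔ k)
    -- (ii)
    (hid2 : ∀ k ∈ Set.Ioo a b,
      (∑ i ∈ N₁, (δ i / (1 - δ i)) * (p i * VL k - e i))
        + (k - (N₁.card : ℝ)) * VΔ k + VL k = 1)
    (μ : ι → ℝ → ℝ)
    (hμ1 : ∀ i ∈ N₁, ∀ k, μ i k = 1 - p i)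
    (hμ2 : ∀ i ∈ N₂, ∀ k, μ i k = 1 / δ i - p i - (p i * VL k - e i) / VΔ k)
    (hμ3 : ∀ i ∈ N₃, ∀ k, μ i k = 0)
    (hμbound : ∀ i ∈ N₂, ∀ k ∈ Set.Ioo a b, 0 ≤ μ i k ∧ μ i k ≤ 1 - p i) :
    AntitoneOn VL (Set.Ioo a b) ∧ MonotoneOn VΔ (Set.Ioo a b) ∧
      ∀ i, AntitoneOn (fun k => VL k + VΔ k - μ i k * VΔ k / (1 - p i))
        (Set.Ioo a b) := by
  have hP2 : 0 < ∑ i ∈ N₂, p i := Finset.sum_pos (fun i _ => (hp i).1) hN₂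
  have hP1 : 0 ≤ ∑ i ∈ N₁, p i := Finset.sum_nonneg (fun i _ => (hp i).1.le)
  have hP12 : ∑ i ∈ N₁, p i + ∑ i ∈ N₂, p i ≤ 1 := by
    rw [← Finset.sum_union hdisj12, ← hpsum]
    exact Finset.sum_le_sum_of_subset_of_nonneg (Finset.subset_univ _)
      (fun i _ _ => (hp i).1.le)
  have hq : ∀ i, 0 ≤ δ i / (1 - δ i) ∧ δ i / (1 - δ i) ≤ 1 := fun i => by
    obtain ⟨h1, h2⟩ := hδ i
    have : 0 < 1 - δ i := by linarith
    exact ⟨by positivity, by rw [div_le_one this]; linarith⟩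
  have hQ : 0 ≤ ∑ i ∈ N₁, δ i / (1 - δ i) * p i :=
    Finset.sum_nonneg (fun i _ => mul_nonneg (hq i).1 (hp i).1.le)
  have hQ1 : ∑ i ∈ N₁, δ i / (1 - δ i) * p i ≤ ∑ i ∈ N₁, p i :=
    Finset.sum_le_sum (fun i _ => mul_le_of_le_one_left (hp i).1.le (hq i).2)
  have hinv : ∀ i, 2 ≤ 1 / δ i := fun i => by
    obtain ⟨h1, h2⟩ := hδ i
    rw [le_div_iff₀ h1]; linarith
  have hS : 2 ≤ ∑ i ∈ N₂, 1 / δ i := by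
    obtain ⟨j, hj⟩ := hN₂
    exact (hinv j).trans (Finset.single_le_sum (f := fun i => 1 / δ i)
      (fun i _ => by linarith [hinv i]) hj)
  have key : ∀ k ∈ Set.Ioo a b, ∀ k' ∈ Set.Ioo a b, k ≤ k' →
      VL k' - VL k ≤ 0 ∧ 0 ≤ VΔ k' - VΔ k ∧ (VL k' - VL k) + (VΔ k' - VΔ k) ≤ 0 := by
    intro k hk k' hk' hkk
    have e1 := hid1 k hk
    have e1' := hid1 k' hk'
    have e2 := hid2 k hk
    have e2' := hid2 k' hk'
    have hnn : 0 ≤ ∑ i ∈ N₂, (p i * VL k - e i) := by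
      refine Finset.sum_nonneg (fun i hi => ?_)
      have hb := (hμbound i hi k hk).2
      rw [hμ2 i hi k] at hb
      have h0 : 0 ≤ (p i * VL k - e i) / VΔ k := by linarith [hinv i]
      have := mul_nonneg h0 (hVΔpos k hk).le
      rwa [div_mul_cancel₀ _ (hVΔpos k hk).ne'] at this
    simp only [Finset.sum_add_distrib, Finset.sum_sub_distrib, ← Finset.sum_mul, mul_sub,
      ← mul_assoc, Finset.sum_const, nsmul_eq_mul, mul_one] at e1 e1' e2 e2' hnn
    have hB : 0 ≤ ∑ i ∈ N₂, 1 / δ i - ∑ i ∈ N₂, p i + (N₁.card - ∑ i ∈ N₁, p i) - (k - 1) := by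
      refine nonneg_of_mul_nonneg_left ?_ (hVΔpos k hk)
      linarith
    refine psm_aux (∑ i ∈ N₂, p i) (∑ i ∈ N₁, δ i / (1 - δ i) * p i) _ (k - N₁.card) (k' - k)
      _ _ (VΔ k') hP2 (by linarith) hQ hB (by linarith [hI k hk]) (by linarith)
      (hVΔpos k' hk') ?_ ?_ (by linarith)
    · linear_combination e1' - e1
    · linear_combination e2' - e2
  refine ⟨fun k hk k' hk' h => by linarith [(key k hk k' hk' h).1],
    fun k hk k' hk' h => by linarith [(key k hk k' hk' h).2.1], fun i k hk k' hk' h => ?_⟩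
  obtain ⟨h1, h2, h3⟩ := key k hk k' hk' h
  have hpi : 0 < 1 - p i := by linarith [(hp i).2]
  have hi : i ∈ N₁ ∪ N₂ ∪ N₃ := hcover ▸ Finset.mem_univ i
  simp only [Finset.mem_union] at hi
  rcases hi with (hi | hi) | hi
  · simp only [hμ1 i hi, mul_div_cancel_left₀ _ hpi.ne']
    linarith
  · have hf : ∀ t ∈ Set.Ioo a b, VL t + VΔ t - μ i t * VΔ t / (1 - p i)
        = (VL t + (1 - 1 / δ i) * VΔ t - e i) / (1 - p i) := by
      intro t ht
      have hm : μ i t * VΔ t = (1 / δ i - p i) * VΔ t - (p i * VL t - e i) := by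
        rw [hμ2 i hi t, sub_mul _ _ (VΔ t), div_mul_cancel₀ _ (hVΔpos t ht).ne']
      rw [hm, eq_div_iff hpi.ne', sub_mul, div_mul_cancel₀ _ hpi.ne']
      ring
    simp only [hf k hk, hf k' hk']
    refine div_le_div_of_nonneg_right ?_ hpi.le
    have := mul_nonneg (show 0 ≤ 1 / δ i - 1 by linarith [hinv i]) h2
    linarith
  · simp only [hμ3 i hi, zero_mul, zero_div]
    linarith
end

section
/- Let f, c : [0,∞) → ℝ satisfy Assumption 1, let x > 0, p ∈ (0,1), α > 0, β ≥ 0, μ ≥ 0, V^Δ ≥ 0, V_L ≥ 0, S ≥ 0, and let k, m be integers with k ≥ 1 and 0 ≤ m ≤ k−1 such that V_L + S + (k−m)·V^Δ = 1. Suppose the first-order condition c′(x)·(α f(x) + β)/(α f′(x)) = p(1−p)·(V_L + (1−p−μ)·V^Δ/(1−p)) holds. Then V_L + V^Δ ≤ 1 and c′(x)·f(x)/f′(x) ≤ p(1−p). -/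
/-- Assumption 1: `f` and `c` are twice differentiable on `(0,∞)` with
`f(0) = 0`, `f′ > 0`, `f″ ≤ 0`, `c(0) = 0`, `c′ > 0`, and `c″ ≥ 0`. -/
def Assumption1 (f c : ℝ → ℝ) : Prop :=
  (∀ y > (0:ℝ), DifferentiableAt ℝ f y) ∧ (∀ y > (0:ℝ), DifferentiableAt ℝ (deriv f) y) ∧
  f 0 = 0 ∧ (∀ y > (0:ℝ), 0 < deriv f y) ∧ (∀ y > (0:ℝ), deriv (deriv f) y ≤ 0) ∧
  (∀ y > (0:ℝ), DifferentiableAt ℝ c y) ∧ (∀ y > (0:ℝ), DifferentiableAt ℝ (deriv c) y) ∧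
  c 0 = 0 ∧ (∀ y > (0:ℝ), 0 < deriv c y) ∧ (∀ y > (0:ℝ), 0 ≤ deriv (deriv c) y)

/-- Key inequality in the proof of Theorem 2: the first-order condition of the
bargaining game, together with the accounting identity, implies
`V_L + V^Δ ≤ 1` and `c′(x)·f(x)/f′(x) ≤ p(1−p)`. -/
theorem key_inequality (f c : ℝ → ℝ) (hfc : Assumption1 f c)
    (x : ℝ) (hx : 0 < x) (p : ℝ) (hp : 0 < p ∧ p < 1)
    (α β μ VΔ VL S : ℝ) (hα : 0 < α) (hβ : 0 ≤ β) (hμ : 0 ≤ μ)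
    (hVΔ : 0 ≤ VΔ) (hVL : 0 ≤ VL) (hS : 0 ≤ S)
    (k m : ℤ) (hk : 1 ≤ k) (hm0 : 0 ≤ m) (hm : m ≤ k - 1)
    (hacct : VL + S + ((k : ℝ) - (m : ℝ)) * VΔ = 1)
    (hfoc : deriv c x * (α * f x + β) / (α * deriv f x)
      = p * (1 - p) * (VL + (1 - p - μ) * VΔ / (1 - p))) :
    VL + VΔ ≤ 1 ∧ deriv c x * f x / deriv f x ≤ p * (1 - p) := by
  obtain ⟨hp0, hp1⟩ := hp
  obtain ⟨-, -, -, hf, -, -, -, -, hc, -⟩ := hfc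
  have hf := hf x hx
  have hc := hc x hx
  have hkm : (1:ℝ) ≤ (k:ℝ) - (m:ℝ) := by
    have h : (m:ℝ) ≤ (k:ℝ) - 1 := by exact_mod_cast hm
    linarith
  have h1 : VL + VΔ ≤ 1 := by nlinarith [mul_le_mul_of_nonneg_right hkm hVΔ]
  refine ⟨h1, ?_⟩
  have hq : 0 < 1 - p := by linarith
  have h2 : (1 - p - μ) * VΔ / (1 - p) ≤ VΔ := by
    rw [div_le_iff₀ hq]
    nlinarith [mul_nonneg hμ hVΔ]
  have h3 : deriv c x * (α * f x + β) / (α * deriv f x)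
      = deriv c x * f x / deriv f x + deriv c x * β / (α * deriv f x) := by
    field_simp
  have h4 : 0 ≤ deriv c x * β / (α * deriv f x) := by positivity
  have h5 : p * (1 - p) * (VL + (1 - p - μ) * VΔ / (1 - p)) ≤ p * (1 - p) * 1 :=
    mul_le_mul_of_nonneg_left (by linarith) (by positivity)
  linarith
end

section
/- Let f̃ : [0,∞) → ℝ be differentiable with f̃′ > 0 and f̃′ non-increasing, let c : [0,∞) → ℝ be differentiable with c(0) = 0, c′ > 0, and c′ non-decreasing, and let Y > 0, V_L > 0, V^Δ ≥ 0, and δ ∈ (0,1). Then the function ψ(y) := Y·c′(y)/f̃′(y) − med{ (1 − f̃(y)/Y)·(V_L+V^Δ), (1 − f̃(y)/Y)·V_L, V_L + V^Δ − V^Δ/δ − c(y) } is strictly increasing on [0,∞). -/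
/-- The median (middle value) of three reals. -/
noncomputable def med (a b c : ℝ) : ℝ := a + b + c - max a (max b c) - min a (min b c)

theorem med_lt_aux {a b c a' b' c' : ℝ} (h1 : a < a') (h2 : b < b') (h3 : c < c') :
    med a b c < med a' b' c' := by
  unfold med
  rcases le_total a b with h | h <;> rcases le_total b c with k | k <;>
  rcases le_total a c with l | l <;> rcases le_total a' b' with h' | h' <;>
  rcases le_total b' c' with k' | k' <;> rcases le_total a' c' with l' | l' <;>
  simp only [max_eq_left, max_eq_right, min_eq_left, min_eq_right, h, k, l, h', k', l'] <;>
  linarith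

theorem strictMono_aux (f : ℝ → ℝ) (hd : ∀ y ∈ Set.Ici (0:ℝ), DifferentiableAt ℝ f y)
    (hp : ∀ y ∈ Set.Ici (0:ℝ), 0 < deriv f y) : StrictMonoOn f (Set.Ici (0:ℝ)) :=
  strictMonoOn_of_deriv_pos (convex_Ici 0)
    (fun y hy => (hd y hy).continuousAt.continuousWithinAt)
    (fun y hy => hp y (interior_subset hy))

/-- Step I of the proof of Theorem 1: the first-order-condition residual is
strictly increasing in effort. -/
theorem foc_residual_strictMono (ftil c : ℝ → ℝ)
    (hfd : ∀ y ∈ Set.Ici (0:ℝ), DifferentiableAt ℝ ftil y)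
    (hf' : ∀ y ∈ Set.Ici (0:ℝ), 0 < deriv ftil y)
    (hf'anti : AntitoneOn (deriv ftil) (Set.Ici (0:ℝ)))
    (hcd : ∀ y ∈ Set.Ici (0:ℝ), DifferentiableAt ℝ c y)
    (hc0 : c 0 = 0)
    (hc' : ∀ y ∈ Set.Ici (0:ℝ), 0 < deriv c y)
    (hc'mono : MonotoneOn (deriv c) (Set.Ici (0:ℝ)))
    (Y VL VΔ δ : ℝ) (hY : 0 < Y) (hVL : 0 < VL) (hVΔ : 0 ≤ VΔ)
    (hδ : 0 < δ ∧ δ < 1) :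
    StrictMonoOn
      (fun y => Y * deriv c y / deriv ftil y -
        med ((1 - ftil y / Y) * (VL + VΔ)) ((1 - ftil y / Y) * VL)
          (VL + VΔ - VΔ / δ - c y))
      (Set.Ici (0:ℝ)) := by
  intro x hx y hy hxy
  have hf := strictMono_aux ftil hfd hf' hx hy hxy
  have hc := strictMono_aux c hcd hc' hx hy hxy
  have hq : 1 - ftil y / Y < 1 - ftil x / Y := by
    have := div_lt_div_of_pos_right hf hY
    linarith
  have hm := med_lt_aux (mul_lt_mul_of_pos_right hq (by linarith : 0 < VL + VΔ))
    (mul_lt_mul_of_pos_right hq hVL)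
    (by linarith : VL + VΔ - VΔ / δ - c y < VL + VΔ - VΔ / δ - c x)
  have hr : Y * deriv c x / deriv ftil x ≤ Y * deriv c y / deriv ftil y :=
    div_le_div₀ (mul_pos hY (hc' y hy)).le
      (mul_le_mul_of_nonneg_left (hc'mono hx hy hxy.le) hY.le) (hf' y hy)
      (hf'anti hx hy hxy.le)
  show _ - _ < _ - _
  linarith
end
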